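/- arXiv:2010.08843 — 4 statements merged into one kernel-verified Lean document; each statement's English description precedes it below -/
import Mathlib

section
/- (Proposition: (AP2a) and (AP2b) imply (AP2).) Fix a time t, a history h_t, and an action a_t. Let μ^y_t and ν^y_t be two probability measures on the observation space 𝒴 (the true conditional law of Y_t given (h_t, a_t), and its approximation), let σ̂_t^{upd} : Ẑ_t × 𝒴 × 𝒜 → Ẑ_{t+1} be a measurable update map, and suppose the compressed states satisfy σ̂_{t+1}(h_t, y_t, a_t) = σ̂_t^{upd}(σ̂_t(h_t), y_t, a_t) for all y_t. Define the pushforward kernel P̂_t(B | σ̂_t(h_t), a_t) = ∫_𝒴 1_B(σ̂_t^{upd}(σ̂_t(h_t), y, a_t)) ν^y_t(dy), and let μ_t(B) = ∫_𝒴 1_B(σ̂_t^{upd}(σ̂_t(h_t), y, a_t)) μ^y_t(dy) and ν_t(B) = P̂_t(B | σ̂_t(h_t), a_t). If d_𝔉(μ^y_t, ν^y_t) ≤ δ_t / κ_𝔉(σ̂_t^{upd}), where κ_𝔉(σ̂_t^{upd}) = sup over (ẑ, a) of sup_{f ∈ 𝔉} ρ_𝔉(f ∘ σ̂_t^{upd}(ẑ,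 ·, a)), then d_𝔉(μ_t, ν_t) ≤ δ_t. -/
open MeasureTheory ProbabilityTheory

universe u

/-- The integral probability metric (IPM) associated with a function class `F`. -/
noncomputable def ipm {X : Type u} [MeasurableSpace X] (F : Set (X → ℝ))
    (μ ν : Measure X) : ℝ :=
  sSup ((fun f => |∫ x, f x ∂μ - ∫ x, f x ∂ν|) '' F)

/-- The Minkowski functional (gauge) of a function `f` with respect to the class `F`. -/
noncomputable def mink {X : Type u} (F : Set (X → ℝ)) (f : X → ℝ) : ℝ :=
  sInf {c : ℝ | 0 < c ∧ (fun x => c⁻¹ * f x) ∈ F}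

/-- `F` is a class of uniformly bounded measurable real-valued functions. -/
def UnifBddMeas {X : Type u} [MeasurableSpace X] (F : Set (X → ℝ)) : Prop :=
  (∀ f ∈ F, Measurable f) ∧ ∃ C : ℝ, ∀ f ∈ F, ∀ x, |f x| ≤ C

theorem ipm_nonneg {X : Type u} [MeasurableSpace X] (F : Set (X → ℝ)) (μ ν : Measure X) :
    0 ≤ ipm F μ ν :=
  Real.sSup_nonneg (by rintro _ ⟨f, -, rfl⟩; exact abs_nonneg _)

theorem abs_integral_sub_le_ipm {X : Type u} [MeasurableSpace X] {F : Set (X → ℝ)}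
    (hF : UnifBddMeas F) (μ ν : Measure X) [IsProbabilityMeasure μ] [IsProbabilityMeasure ν]
    {f : X → ℝ} (hf : f ∈ F) : |∫ x, f x ∂μ - ∫ x, f x ∂ν| ≤ ipm F μ ν := by
  obtain ⟨C, hC⟩ := hF.2
  have hint : ∀ (ρ : Measure X) [IsProbabilityMeasure ρ], ∀ g ∈ F, |∫ x, g x ∂ρ| ≤ C := by
    intro ρ _ g hg
    simpa using norm_integral_le_of_norm_le_const (μ := ρ) (f := g) (.of_forall (hC g hg))
  refine le_csSup ⟨C + C, ?_⟩ ⟨f, hf, rfl⟩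
  rintro _ ⟨g, hg, rfl⟩
  exact (abs_sub _ _).trans (add_le_add (hint μ g hg) (hint ν g hg))

/-- The defining inequality of the Minkowski functional: an integral discrepancy is at most the
gauge of the integrand times the integral probability metric. -/
theorem abs_integral_sub_le_mink_mul_ipm {X : Type u} [MeasurableSpace X] {F : Set (X → ℝ)}
    (hF : UnifBddMeas F) (μ ν : Measure X) [IsProbabilityMeasure μ] [IsProbabilityMeasure ν]
    {g : X → ℝ} (hg : {c : ℝ | 0 < c ∧ (fun x => c⁻¹ * g x) ∈ F}.Nonempty) :
    |∫ x, g x ∂μ - ∫ x, g x ∂ν| ≤ mink F g * ipm F μ ν := by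
  have key : ∀ c ∈ {c : ℝ | 0 < c ∧ (fun x => c⁻¹ * g x) ∈ F},
      |∫ x, g x ∂μ - ∫ x, g x ∂ν| ≤ c * ipm F μ ν := by
    rintro c ⟨hc, hcF⟩
    have h := abs_integral_sub_le_ipm hF μ ν hcF
    simp only [integral_const_mul, ← mul_sub, abs_mul, abs_of_pos (inv_pos.2 hc)] at h
    exact (inv_mul_le_iff₀ hc).1 h
  rcases (ipm_nonneg F μ ν).eq_or_lt with h0 | hpos
  · obtain ⟨c, hc⟩ := hg
    simpa [← h0] using key c hc
  · rw [← div_le_iff₀ hpos]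
    exact le_csInf hg fun c hc => (div_le_iff₀ hpos).2 (key c hc)

/-- **Proposition: (AP2a) and (AP2b) imply (AP2).** Fix a time step, a history
(represented through its compressed state `z = σ̂_t(h_t)`) and an action `a`. Let `μy, νy` be
the true and approximate conditional laws of the observation, and let
`upd : Ẑ_t × 𝒴 × 𝒜 → Ẑ_{t+1}` be the measurable AIS update map, so that
`σ̂_{t+1}(h_t, y, a) = upd (σ̂_t h_t) y a`.  The measures `μ_t` and `ν_t` of (AP2) are then the
pushforwards of `μy` and `νy` under `y ↦ upd z y a`.  If
`d_𝔉(μy, νy) ≤ δ / κ_𝔉(upd)`, where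
`κ_𝔉(upd) = sup_{(ẑ,a)} sup_{f ∈ 𝔉} ρ_𝔉(f ∘ upd(ẑ, ·, a))`, then `d_𝔉(μ_t, ν_t) ≤ δ`. -/
theorem ais_update_ipm_bound {Y Z Z' A : Type u}
    [MeasurableSpace Y] [MeasurableSpace Z] [MeasurableSpace Z']
    (FY : Set (Y → ℝ)) (FZ : Set (Z' → ℝ))
    (hFY : UnifBddMeas FY) (hFZ : UnifBddMeas FZ)
    (upd : Z → Y → A → Z') (hupd : ∀ z a, Measurable (fun y => upd z y a))
    (μy νy : Measure Y) [IsProbabilityMeasure μy] [IsProbabilityMeasure νy]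
    (z : Z) (a : A) (δ : ℝ) (hδ : 0 < δ)
    (κ : ℝ)
    (hκ : κ = sSup (Set.range fun p : Z × A =>
      sSup ((fun f => mink FY (fun y => f (upd p.1 y p.2))) '' FZ)))
    (hκpos : 0 < κ)
    (hfin : ∀ f ∈ FZ, ∀ (z' : Z) (a' : A),
      {c : ℝ | 0 < c ∧ (fun y => c⁻¹ * f (upd z' y a')) ∈ FY}.Nonempty)
    (hbdd1 : ∀ p : Z × A,
      BddAbove ((fun f => mink FY (fun y => f (upd p.1 y p.2))) '' FZ))
    (hbdd2 : BddAbove (Set.range fun p : Z × A =>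
      sSup ((fun f => mink FY (fun y => f (upd p.1 y p.2))) '' FZ)))
    (hsmall : ipm FY μy νy ≤ δ / κ) :
    ipm FZ (μy.map (fun y => upd z y a)) (νy.map (fun y => upd z y a)) ≤ δ := by
  refine Real.sSup_le ?_ hδ.le
  rintro _ ⟨f, hf, rfl⟩
  have hmap : ∀ ρ : Measure Y,
      ∫ x, f x ∂(ρ.map fun y => upd z y a) = ∫ y, f (upd z y a) ∂ρ := fun ρ =>
    integral_map (hupd z a).aemeasurable (hFZ.1 f hf).aestronglyMeasurable
  have hmink : mink FY (fun y => f (upd z y a)) ≤ κ :=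
    hκ ▸ (le_csSup (hbdd1 (z, a)) ⟨f, hf, rfl⟩).trans (le_csSup hbdd2 ⟨(z, a), rfl⟩)
  simp only [hmap]
  calc |∫ y, f (upd z y a) ∂μy - ∫ y, f (upd z y a) ∂νy|
      ≤ mink FY (fun y => f (upd z y a)) * ipm FY μy νy :=
        abs_integral_sub_le_mink_mul_ipm hFY μy νy (hfin f hf z a)
    _ ≤ κ * ipm FY μy νy := mul_le_mul_of_nonneg_right hmink (ipm_nonneg FY μy νy)
    _ ≤ δ := (le_div_iff₀' hκpos).1 hsmall
end

section
/- (Theorem, value function approximation for AIS.) Suppose {σ̂_t, P̂_t, r̂_t}_{t=1}^T is an (ε_t, δ_t)-approximate information state (AIS) generator. Define the AIS value functions by V̂_{T+1} ≡ 0 and, for t = T,…,1, Q̂_t(ẑ,a) = r̂_t(ẑ,a) + ∫ V̂_{t+1}(ẑ') P̂_t(dẑ' | ẑ, a) and V̂_t(ẑ) = max_{a∈𝒜} Q̂_t(ẑ,a). Then for every time t, every history h_t, and every action a_t: |Q_t(h_t, a_t) − Q̂_t(σ̂_t(h_t), a_t)| ≤ α_t and |V_t(h_t) − V̂_t(σ̂_t(h_t))|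 ≤ α_t, where α_{T+1} = 0 and α_t = ε_t + ρ_𝔉(V̂_{t+1}) δ_t + α_{t+1}. -/
open MeasureTheory ProbabilityTheory

universe u

/-- History spaces of a partially observed system: `ℋ_{t+1} = ℋ_t × 𝒴 × 𝒜`. -/
def Hist (H0 Y A : Type u) : ℕ → Type u
  | 0 => H0
  | (t+1) => Hist H0 Y A t × Y × A

instance Hist.instMeasurableSpace {H0 Y A : Type u} [MeasurableSpace H0]
    [MeasurableSpace Y] [MeasurableSpace A] :
    ∀ t, MeasurableSpace (Hist H0 Y A t)
  | 0 => inferInstanceAs (MeasurableSpace H0)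
  | (t+1) =>
    letI := Hist.instMeasurableSpace (H0 := H0) (Y := Y) (A := A) t
    inferInstanceAs (MeasurableSpace (Hist H0 Y A t × Y × A))

theorem abs_integral_sub_le_mink_mul {X : Type u} [MeasurableSpace X] {F : Set (X → ℝ)}
    (hF : UnifBddMeas F) (μ ν : Measure X) [IsProbabilityMeasure μ] [IsProbabilityMeasure ν]
    {f : X → ℝ} (hf : {c : ℝ | 0 < c ∧ (fun x => c⁻¹ * f x) ∈ F}.Nonempty)
    {d : ℝ} (hd : ipm F μ ν ≤ d) :
    |∫ x, f x ∂μ - ∫ x, f x ∂ν| ≤ mink F f * d := by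
  have key : ∀ c ∈ {c : ℝ | 0 < c ∧ (fun x => c⁻¹ * f x) ∈ F},
      |∫ x, f x ∂μ - ∫ x, f x ∂ν| ≤ c * d := by
    rintro c ⟨hc, hcF⟩
    have h := (abs_integral_sub_le_ipm hF μ ν hcF).trans hd
    rwa [integral_const_mul, integral_const_mul, ← mul_sub, abs_mul,
      abs_of_pos (inv_pos.2 hc), inv_mul_le_iff₀ hc] at h
  rcases ((ipm_nonneg F μ ν).trans hd).eq_or_lt with h0 | hpos
  · obtain ⟨c, hc⟩ := hf
    simpa [← h0] using key c hc
  · rw [← div_le_iff₀ hpos]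
    exact le_csInf hf fun c hc => (div_le_iff₀ hpos).2 (key c hc)

theorem UnifBddMeas.measurable_and_bounded_of_inv_mul_mem {X : Type u} [MeasurableSpace X]
    {F : Set (X → ℝ)} (hF : UnifBddMeas F) {f : X → ℝ} {c : ℝ} (hc : 0 < c)
    (hf : (fun x => c⁻¹ * f x) ∈ F) : Measurable f ∧ ∃ C : ℝ, ∀ x, |f x| ≤ C := by
  obtain ⟨hm, C, hC⟩ := hF
  refine ⟨?_, c * C, fun x => ?_⟩
  · have h := (hm _ hf).const_mul c
    simpa [mul_inv_cancel_left₀ hc.ne'] using h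
  · have h := hC _ hf x
    rwa [abs_mul, abs_of_pos (inv_pos.2 hc), inv_mul_le_iff₀ hc] at h

theorem abs_ciSup_sub_ciSup_le {ι : Type*} [Finite ι] [Nonempty ι] {f g : ι → ℝ} {b : ℝ}
    (h : ∀ i, |f i - g i| ≤ b) : |(⨆ i, f i) - ⨆ i, g i| ≤ b := by
  have hf := (Set.finite_range f).bddAbove
  have hg := (Set.finite_range g).bddAbove
  rw [abs_sub_le_iff, sub_le_iff_le_add, sub_le_iff_le_add]
  constructor
  · refine ciSup_le fun i => ?_
    linarith [(abs_sub_le_iff.1 (h i)).1, le_ciSup hg i]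
  · refine ciSup_le fun i => ?_
    linarith [(abs_sub_le_iff.1 (h i)).2, le_ciSup hf i]

/-- Appending a fixed action to a history and an observation is measurable. -/
theorem Hist.measurable_append {H0 Y A : Type u} [MeasurableSpace H0] [MeasurableSpace Y]
    [MeasurableSpace A] (t : ℕ) (a : A) :
    Measurable (fun p : Hist H0 Y A t × Y => ((p.1, p.2, a) : Hist H0 Y A (t+1))) :=
  measurable_fst.prodMk (measurable_snd.prodMk measurable_const)

/-- **Theorem: value function approximation for AIS.**
Consider a finite-horizon partially observed system with horizon `T`: observation space `Y`,
finite action space `A`, history spaces `Hist H0 Y A t`, a Markov kernel `obs t` giving the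
conditional law of the observation `Y_t` given `(H_t, A_t)`, and bounded measurable expected
reward `r t (h, a) = E[R_t | H_t = h, A_t = a]`.  Let `{σ, Phat, rhat}` be an
`(ε_t, δ_t)`-AIS generator ((AP1) and (AP2)), let `Q, V` be the optimal value functions, and
`Qhat, Vhat` the AIS value functions defined by the backward recursions.  Then
`|Q_t(h_t,a_t) − Q̂_t(σ̂_t(h_t),a_t)| ≤ α_t` and `|V_t(h_t) − V̂_t(σ̂_t(h_t))| ≤ α_t`, where
`α_{T+1} = 0` and `α_t = ε_t + ρ_𝔉(V̂_{t+1}) δ_t + α_{t+1}`. -/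
theorem ais_value_approximation
    {H0 Y A : Type u} [MeasurableSpace H0] [MeasurableSpace Y] [MeasurableSpace A]
    [Fintype A] [Nonempty A]
    (T : ℕ)
    (obs : ∀ t, Kernel (Hist H0 Y A t × A) Y) [∀ t, IsMarkovKernel (obs t)]
    (r : ∀ t, Hist H0 Y A t × A → ℝ)
    (hrm : ∀ t, Measurable (r t)) (hrb : ∃ C : ℝ, ∀ t p, |r t p| ≤ C)
    -- the AIS generator
    {Z : ℕ → Type u} [∀ t, MeasurableSpace (Z t)]
    (σ : ∀ t, Hist H0 Y A t → Z t) (hσ : ∀ t, Measurable (σ t))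
    (Phat : ∀ t, Kernel (Z t × A) (Z (t+1))) [∀ t, IsMarkovKernel (Phat t)]
    (rhat : ∀ t, Z t × A → ℝ)
    (hrhatm : ∀ t, Measurable (rhat t)) (hrhatb : ∃ C : ℝ, ∀ t p, |rhat t p| ≤ C)
    (F : ∀ t, Set (Z t → ℝ)) (hF : ∀ t, UnifBddMeas (F t))
    (ε δ : ℕ → ℝ)
    (hAP1 : ∀ t ≤ T, ∀ (h : Hist H0 Y A t) (a : A),
      |r t (h, a) - rhat t (σ t h, a)| ≤ ε t)
    (hAP2 : ∀ t ≤ T, ∀ (h : Hist H0 Y A t) (a : A),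
      ipm (F (t+1))
        (((obs t) (h, a)).map (fun y => σ (t+1) ((h, y, a) : Hist H0 Y A (t+1))))
        ((Phat t) (σ t h, a)) ≤ δ t)
    -- the optimal value functions
    (Q : ∀ t, Hist H0 Y A t → A → ℝ) (V : ∀ t, Hist H0 Y A t → ℝ)
    (hVT : ∀ h, V (T+1) h = 0)
    (hQ : ∀ t ≤ T, ∀ (h : Hist H0 Y A t) (a : A),
      Q t h a = r t (h, a) +
        ∫ y, V (t+1) ((h, y, a) : Hist H0 Y A (t+1)) ∂((obs t) (h, a)))
    (hV : ∀ t ≤ T, ∀ h : Hist H0 Y A t, V t h = ⨆ a : A, Q t h a)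
    -- the AIS value functions
    (Qhat : ∀ t, Z t → A → ℝ) (Vhat : ∀ t, Z t → ℝ)
    (hVhatT : ∀ z, Vhat (T+1) z = 0)
    (hQhat : ∀ t ≤ T, ∀ (z : Z t) (a : A),
      Qhat t z a = rhat t (z, a) + ∫ z', Vhat (t+1) z' ∂((Phat t) (z, a)))
    (hVhat : ∀ t ≤ T, ∀ z : Z t, Vhat t z = ⨆ a : A, Qhat t z a)
    -- finiteness of the Minkowski functionals ρ_𝔉(V̂_{t+1})
    (hmink : ∀ t ≤ T,
      {c : ℝ | 0 < c ∧ (fun z => c⁻¹ * Vhat (t+1) z) ∈ F (t+1)}.Nonempty)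
    -- the error recursion
    (α : ℕ → ℝ) (hαT : α (T+1) = 0)
    (hα : ∀ t ≤ T, α t = ε t + mink (F (t+1)) (Vhat (t+1)) * δ t + α (t+1)) :
    ∀ t ≤ T, ∀ (h : Hist H0 Y A t) (a : A),
      |Q t h a - Qhat t (σ t h) a| ≤ α t ∧ |V t h - Vhat t (σ t h)| ≤ α t := by
  have hQm : ∀ t ≤ T, Measurable (V (t+1)) → ∀ a, Measurable (fun h => Q t h a) := by
    intro t ht hVm a
    simp_rw [hQ t ht]
    have hpair : Measurable (fun h : Hist H0 Y A t => (h, a)) := measurable_prodMk_right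
    refine ((hrm t).comp hpair).add ?_
    exact (StronglyMeasurable.integral_kernel_prod_right (κ := (obs t).comap _ hpair)
      (f := fun h y => V (t+1) ((h, y, a) : Hist H0 Y A (t+1)))
      (hVm.comp (Hist.measurable_append t a)).stronglyMeasurable).measurable
  have hstep : ∀ t ≤ T, Measurable (V (t+1)) →
      (∀ h, |V (t+1) h - Vhat (t+1) (σ (t+1) h)| ≤ α (t+1)) →
      ∀ h a, |Q t h a - Qhat t (σ t h) a| ≤ α t := by
    intro t ht hVm hVα h a
    obtain ⟨c, hc, hcF⟩ := hmink t ht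
    obtain ⟨hVhm, C, hC⟩ := (hF (t+1)).measurable_and_bounded_of_inv_mul_mem hc hcF
    have happ : Measurable (fun y => ((h, y, a) : Hist H0 Y A (t+1))) :=
      (Hist.measurable_append t a).comp measurable_prodMk_left
    have hσy : Measurable (fun y => σ (t+1) ((h, y, a) : Hist H0 Y A (t+1))) :=
      (hσ (t+1)).comp happ
    have hdiff : |(∫ y, V (t+1) ((h, y, a) : Hist H0 Y A (t+1)) ∂(obs t (h, a))) -
        ∫ y, Vhat (t+1) (σ (t+1) ((h, y, a) : Hist H0 Y A (t+1))) ∂(obs t (h, a))|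
        ≤ α (t+1) := by
      have hVhi : Integrable (fun y => Vhat (t+1) (σ (t+1) ((h, y, a) : Hist H0 Y A (t+1))))
          (obs t (h, a)) :=
        .of_bound (hVhm.comp hσy).aestronglyMeasurable C (.of_forall fun y => hC _)
      have hdi : Integrable (fun y => V (t+1) ((h, y, a) : Hist H0 Y A (t+1)) -
          Vhat (t+1) (σ (t+1) ((h, y, a) : Hist H0 Y A (t+1)))) (obs t (h, a)) :=
        .of_bound ((hVm.comp happ).sub (hVhm.comp hσy)).aestronglyMeasurable (α (t+1))
          (.of_forall fun y => hVα _)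
      have hVi : Integrable (fun y => V (t+1) ((h, y, a) : Hist H0 Y A (t+1)))
          (obs t (h, a)) := by
        refine (hdi.add hVhi).congr (.of_forall fun y => ?_)
        exact sub_add_cancel _ _
      rw [← integral_sub hVi hVhi]
      simpa using norm_integral_le_of_norm_le_const (μ := obs t (h, a)) (C := α (t+1))
        (f := fun y => V (t+1) ((h, y, a) : Hist H0 Y A (t+1)) -
          Vhat (t+1) (σ (t+1) ((h, y, a) : Hist H0 Y A (t+1))))
        (.of_forall fun y => hVα ((h, y, a) : Hist H0 Y A (t+1)))
    have : IsProbabilityMeasure ((obs t (h, a)).map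
        (fun y => σ (t+1) ((h, y, a) : Hist H0 Y A (t+1)))) :=
      Measure.isProbabilityMeasure_map hσy.aemeasurable
    have hipm := abs_integral_sub_le_mink_mul (hF (t+1)) _ _ (hmink t ht) (hAP2 t ht h a)
    rw [integral_map hσy.aemeasurable hVhm.aestronglyMeasurable] at hipm
    rw [hQ t ht, hQhat t ht, hα t ht]
    have hr := hAP1 t ht h a
    rw [abs_le] at *
    constructor <;> linarith
  have hVstep : ∀ t ≤ T, (∀ h a, |Q t h a - Qhat t (σ t h) a| ≤ α t) →
      ∀ h, |V t h - Vhat t (σ t h)| ≤ α t := by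
    intro t ht hQα h
    rw [hV t ht, hVhat t ht]
    exact abs_ciSup_sub_ciSup_le (hQα h)
  have hmain : ∀ t ≤ T + 1, Measurable (V t) ∧ ∀ h, |V t h - Vhat t (σ t h)| ≤ α t := by
    intro t ht
    refine Nat.decreasingInduction'
      (P := fun t => Measurable (V t) ∧ ∀ h, |V t h - Vhat t (σ t h)| ≤ α t)
      (fun k hk _ ih => ?_) ht ⟨?_, fun h => ?_⟩
    · have hkT := Nat.lt_succ_iff.1 hk
      refine ⟨?_, hVstep k hkT (hstep k hkT ih.1 ih.2)⟩
      rw [funext (hV k hkT)]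
      exact .iSup (hQm k hkT ih.1)
    · rw [funext hVT]
      exact measurable_const
    · simp [hVT, hVhatT, hαT]
  intro t ht h a
  obtain ⟨hVm, hVα⟩ := hmain (t+1) (Nat.succ_le_succ ht)
  exact ⟨hstep t ht hVm hVα h a, (hmain t (Nat.le_succ_of_le ht)).2 h⟩
end

section
/- (Remark: tighter value-approximation bound.) Suppose {σ̂_t, P̂_t, r̂_t}_{t=1}^T satisfies (AP1) with constants ε_t, and define Δ*_t(V̂_{t+1}) = sup over (h_t, a_t) of |E[V̂_{t+1}(σ̂_{t+1}(H_{t+1})) | H_t = h_t, A_t = a_t] − ∫ V̂_{t+1}(ẑ') P̂_t(dẑ' | σ̂_t(h_t), a_t)|, where Q̂_t, V̂_t are the AIS value functions. Then for every t, h_t, a_t: |Q_t(h_t,a_t) − Q̂_t(σ̂_t(h_t),a_t)| ≤ α_t and |V_t(h_t) − V̂_t(σ̂_t(h_t))| ≤ α_t, where α_{T+1} = 0 and α_t = ε_t + Δ*_t(V̂_{t+1}) + α_{t+1}. -/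
open MeasureTheory ProbabilityTheory

universe u


/-- Suprema over a finite nonempty type are nonexpansive in the sup distance. -/
lemma abs_ciSup_sub_ciSup_le_of_finite {ι : Type*} [Finite ι] [Nonempty ι] {f g : ι → ℝ} {c : ℝ}
    (h : ∀ i, |f i - g i| ≤ c) : |(⨆ i, f i) - ⨆ i, g i| ≤ c := by
  have hf : BddAbove (Set.range f) := (Set.finite_range f).bddAbove
  have hg : BddAbove (Set.range g) := (Set.finite_range g).bddAbove
  have hfg : (⨆ i, f i) ≤ (⨆ i, g i) + c := ciSup_le fun i => by
    linarith [(abs_le.1 (h i)).2, le_ciSup hg i]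
  have hgf : (⨆ i, g i) ≤ (⨆ i, f i) + c := ciSup_le fun i => by
    linarith [(abs_le.1 (h i)).1, le_ciSup hf i]
  exact abs_le.2 ⟨by linarith, by linarith⟩

lemma abs_integral_le_of_forall_abs_le {W : Type*} [MeasurableSpace W] {μ : Measure W}
    [IsProbabilityMeasure μ] {f : W → ℝ} {c : ℝ} (h : ∀ w, |f w| ≤ c) :
    |∫ w, f w ∂μ| ≤ c := by
  simpa using norm_integral_le_of_norm_le_const (μ := μ) (f := f) (C := c) (ae_of_all _ h)

lemma abs_integral_sub_integral_le {W : Type*} [MeasurableSpace W] {μ : Measure W}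
    [IsProbabilityMeasure μ] {f g : W → ℝ} {c : ℝ} (hf : Integrable f μ) (hg : Integrable g μ)
    (h : ∀ w, |f w - g w| ≤ c) : |(∫ w, f w ∂μ) - ∫ w, g w ∂μ| ≤ c := by
  rw [← integral_sub hf hg]
  exact abs_integral_le_of_forall_abs_le h

lemma integrable_of_measurable_of_abs_le {W : Type*} [MeasurableSpace W] {μ : Measure W}
    [IsFiniteMeasure μ] {f : W → ℝ} {c : ℝ} (hf : Measurable f) (h : ∀ w, |f w| ≤ c) :
    Integrable f μ :=
  Integrable.of_bound hf.aestronglyMeasurable c (ae_of_all _ h)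

/-- The Bellman operator preserves bounded measurable functions. -/
lemma measurable_and_bounded_bellman {X W A : Type*} [MeasurableSpace X] [MeasurableSpace W]
    [MeasurableSpace A] [Finite A] [Nonempty A] (κ : Kernel (X × A) W) [IsMarkovKernel κ]
    {ρ : X × A → ℝ} (hρ : Measurable ρ) (hρb : ∃ C, ∀ p, |ρ p| ≤ C)
    {f : A → X × W → ℝ} (hf : ∀ a, Measurable (f a)) (hfb : ∃ C, ∀ a p, |f a p| ≤ C)
    {v : X → ℝ} (hv : ∀ x, v x = ⨆ a, (ρ (x, a) + ∫ w, f a (x, w) ∂κ (x, a))) :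
    Measurable v ∧ ∃ C, ∀ x, |v x| ≤ C := by
  obtain ⟨C, hC⟩ := hρb
  obtain ⟨D, hD⟩ := hfb
  constructor
  · rw [funext hv]
    refine Measurable.iSup fun a => (hρ.comp measurable_prodMk_right).add ?_
    exact ((hf a).stronglyMeasurable.integral_kernel_prod_right'
      (κ := κ.comap (fun x => (x, a)) measurable_prodMk_right)).measurable
  · refine ⟨C + D, fun x => ?_⟩
    have h := abs_ciSup_sub_ciSup_le_of_finite (c := C + D)
      (f := fun a => ρ (x, a) + ∫ w, f a (x, w) ∂κ (x, a)) (g := fun _ => 0) fun a => by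
        rw [sub_zero]
        exact (abs_add_le _ _).trans
          (add_le_add (hC _) (abs_integral_le_of_forall_abs_le fun w => hD a _))
    rw [ciSup_const, sub_zero] at h
    rwa [hv x]

/-- **Remark: tighter value-approximation bound.**
Suppose `{σ, Phat, rhat}` satisfies (AP1) with constants `ε_t`, and define
`Δ*_t(V̂_{t+1}) = sup_{(h_t,a_t)} | E[V̂_{t+1}(σ̂_{t+1}(H_{t+1})) | h_t, a_t]
− ∫ V̂_{t+1} dP̂_t(·|σ̂_t(h_t),a_t) |`.  Then the optimal and AIS value functions satisfy
`|Q_t(h_t,a_t) − Q̂_t(σ̂_t(h_t),a_t)| ≤ α_t` and `|V_t(h_t) − V̂_t(σ̂_t(h_t))| ≤ α_t`, where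
`α_{T+1} = 0` and `α_t = ε_t + Δ*_t(V̂_{t+1}) + α_{t+1}`. -/
theorem ais_value_approximation_tight
    {H0 Y A : Type u} [MeasurableSpace H0] [MeasurableSpace Y] [MeasurableSpace A]
    [Fintype A] [Nonempty A]
    (T : ℕ)
    (obs : ∀ t, Kernel (Hist H0 Y A t × A) Y) [∀ t, IsMarkovKernel (obs t)]
    (r : ∀ t, Hist H0 Y A t × A → ℝ)
    (hrm : ∀ t, Measurable (r t)) (hrb : ∃ C : ℝ, ∀ t p, |r t p| ≤ C)
    -- the AIS compression, kernels and rewards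
    {Z : ℕ → Type u} [∀ t, MeasurableSpace (Z t)]
    (σ : ∀ t, Hist H0 Y A t → Z t) (hσ : ∀ t, Measurable (σ t))
    (Phat : ∀ t, Kernel (Z t × A) (Z (t+1))) [∀ t, IsMarkovKernel (Phat t)]
    (rhat : ∀ t, Z t × A → ℝ)
    (hrhatm : ∀ t, Measurable (rhat t)) (hrhatb : ∃ C : ℝ, ∀ t p, |rhat t p| ≤ C)
    (ε : ℕ → ℝ)
    (hAP1 : ∀ t ≤ T, ∀ (h : Hist H0 Y A t) (a : A),
      |r t (h, a) - rhat t (σ t h, a)| ≤ ε t)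
    -- the optimal value functions
    (Q : ∀ t, Hist H0 Y A t → A → ℝ) (V : ∀ t, Hist H0 Y A t → ℝ)
    (hVT : ∀ h, V (T+1) h = 0)
    (hQ : ∀ t ≤ T, ∀ (h : Hist H0 Y A t) (a : A),
      Q t h a = r t (h, a) +
        ∫ y, V (t+1) ((h, y, a) : Hist H0 Y A (t+1)) ∂((obs t) (h, a)))
    (hV : ∀ t ≤ T, ∀ h : Hist H0 Y A t, V t h = ⨆ a : A, Q t h a)
    -- the AIS value functions
    (Qhat : ∀ t, Z t → A → ℝ) (Vhat : ∀ t, Z t → ℝ)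
    (hVhatT : ∀ z, Vhat (T+1) z = 0)
    (hQhat : ∀ t ≤ T, ∀ (z : Z t) (a : A),
      Qhat t z a = rhat t (z, a) + ∫ z', Vhat (t+1) z' ∂((Phat t) (z, a)))
    (hVhat : ∀ t ≤ T, ∀ z : Z t, Vhat t z = ⨆ a : A, Qhat t z a)
    -- the error recursion with `Δ*_t(V̂_{t+1})`
    (α : ℕ → ℝ) (hαT : α (T+1) = 0)
    (hα : ∀ t ≤ T, α t = ε t +
      sSup (Set.range fun p : Hist H0 Y A t × A =>
        |(∫ y, Vhat (t+1) (σ (t+1) ((p.1, y, p.2) : Hist H0 Y A (t+1)))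
            ∂((obs t) p)) -
         ∫ z', Vhat (t+1) z' ∂((Phat t) (σ t p.1, p.2))|) +
      α (t+1)) :
    ∀ t ≤ T, ∀ (h : Hist H0 Y A t) (a : A),
      |Q t h a - Qhat t (σ t h) a| ≤ α t ∧ |V t h - Vhat t (σ t h)| ≤ α t := by
  obtain ⟨C, hC⟩ := hrb
  obtain ⟨D, hD⟩ := hrhatb
  have hVreg : ∀ t, t ≤ T + 1 → Measurable (V t) ∧ ∃ C, ∀ h, |V t h| ≤ C := by
    intro t ht
    induction ht using Nat.decreasingInduction with
    | self => exact ⟨by rw [funext hVT]; exact measurable_const, 0, fun h => by simp [hVT h]⟩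
    | of_succ t ht ih =>
      obtain ⟨hm, B, hB⟩ := ih
      have ht' : t ≤ T := Nat.lt_succ_iff.1 ht
      refine measurable_and_bounded_bellman (obs t) (hrm t) ⟨C, hC t⟩
        (f := fun a p => V (t + 1) ((p.1, p.2, a) : Hist H0 Y A (t + 1)))
        (fun a => hm.comp ?_) ⟨B, fun a p => hB _⟩ fun h => ?_
      · exact measurable_fst.prodMk (measurable_snd.prodMk measurable_const)
      · simp only [hV t ht' h, hQ t ht' h]
  have hVhatreg : ∀ t, t ≤ T + 1 → Measurable (Vhat t) ∧ ∃ C, ∀ z, |Vhat t z| ≤ C := by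
    intro t ht
    induction ht using Nat.decreasingInduction with
    | self => exact ⟨by rw [funext hVhatT]; exact measurable_const, 0, fun h => by simp [hVhatT h]⟩
    | of_succ t ht ih =>
      obtain ⟨hm, B, hB⟩ := ih
      have ht' : t ≤ T := Nat.lt_succ_iff.1 ht
      refine measurable_and_bounded_bellman (Phat t) (hrhatm t) ⟨D, hD t⟩
        (f := fun _ p => Vhat (t + 1) p.2)
        (fun _ => hm.comp measurable_snd) ⟨B, fun _ p => hB _⟩ fun z => ?_
      simp only [hVhat t ht' z, hQhat t ht' z]
  have hQstep : ∀ t ≤ T, (∀ h, |V (t + 1) h - Vhat (t + 1) (σ (t + 1) h)| ≤ α (t + 1)) →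
      ∀ h a, |Q t h a - Qhat t (σ t h) a| ≤ α t := by
    intro t ht ih h a
    obtain ⟨hm, B, hB⟩ := hVreg (t + 1) (Nat.succ_le_succ ht)
    obtain ⟨hm', B', hB'⟩ := hVhatreg (t + 1) (Nat.succ_le_succ ht)
    have hmk : Measurable fun y : Y => ((h, y, a) : Hist H0 Y A (t + 1)) :=
      measurable_const.prodMk (measurable_id.prodMk measurable_const)
    have hsub : |(∫ y, V (t + 1) ((h, y, a) : Hist H0 Y A (t + 1)) ∂obs t (h, a)) -
        ∫ y, Vhat (t + 1) (σ (t + 1) ((h, y, a) : Hist H0 Y A (t + 1))) ∂obs t (h, a)|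
          ≤ α (t + 1) :=
      abs_integral_sub_integral_le
        (integrable_of_measurable_of_abs_le (hm.comp hmk) fun y => hB _)
        (integrable_of_measurable_of_abs_le (hm'.comp ((hσ (t + 1)).comp hmk)) fun y => hB' _)
        fun y => ih _
    have hbdd : BddAbove (Set.range fun p : Hist H0 Y A t × A =>
        |(∫ y, Vhat (t+1) (σ (t+1) ((p.1, y, p.2) : Hist H0 Y A (t+1)))
            ∂((obs t) p)) -
         ∫ z', Vhat (t+1) z' ∂((Phat t) (σ t p.1, p.2))|) := by
      refine ⟨B' + B', ?_⟩
      rintro _ ⟨p, rfl⟩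
      exact (abs_sub _ _).trans (add_le_add
        (abs_integral_le_of_forall_abs_le fun y => hB' _)
        (abs_integral_le_of_forall_abs_le hB'))
    have hsup := le_csSup hbdd (Set.mem_range_self (h, a))
    rw [hQ t ht, hQhat t ht, hα t ht]
    have hr := hAP1 t ht h a
    rw [abs_le] at hr hsub ⊢
    have hsup' := abs_le.1 hsup
    dsimp only at hsup'
    constructor <;> linarith [hsup'.1, hsup'.2, hr.1, hr.2, hsub.1, hsub.2]
  have hVbound : ∀ t, t ≤ T + 1 → ∀ h, |V t h - Vhat t (σ t h)| ≤ α t := by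
    intro t ht
    induction ht using Nat.decreasingInduction with
    | self => intro h; simp [hVT, hVhatT, hαT]
    | of_succ t ht ih =>
      intro h
      have ht' : t ≤ T := Nat.lt_succ_iff.1 ht
      rw [hV t ht', hVhat t ht']
      exact abs_ciSup_sub_ciSup_le_of_finite fun a => hQstep t ht' ih h a
  exact fun t ht h a => ⟨hQstep t ht (hVbound (t + 1) (Nat.succ_le_succ ht)) h a,
    hVbound t (Nat.le_succ_of_le ht) h⟩
end

section
/- (ε-sufficient statistics induce an AIS.) Consider a POMDP with finite state space 𝒮 (|𝒮| = m), finite action space 𝒜, finite observation space 𝒴, bounded reward r : 𝒮 × 𝒜 → ℝ, and belief process b_t(· | H_t) ∈ Δ(𝒮) with b_t(s | h_t) = P(S_t = s | H_t = h_t). Suppose {φ_t : ℋ_t → Φ_t} and {b̂_t : Φ_t → Δ(𝒮)} form an ε-sufficient statistic, i.e., ‖b̂_t(· | φ_t(h_t)) − b_t(· | h_t)‖_1 ≤ ε for all t, h_t. Metrize the belief space Δ(𝒮) by the total variation distance and use the bounded-Lipschitz IPM on probability measures over Δ(𝒮). Then the compression σ̂_t(h_t) = b̂_t(· | φ_t(h_t)),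 with the reward approximation r̂(b, a) = Σ_{s∈𝒮} b(s) r(s,a) and the update kernel induced by the Bayes filter applied to the approximate beliefs, is an (ε · Span(r), 3ε)-approximate information state generator. -/
universe u

variable {S A Y : Type u}

/-- `b` is a belief (probability vector) on the finite state space `S`. -/
def IsBelief [Fintype S] (b : S → ℝ) : Prop :=
  (∀ s, 0 ≤ b s) ∧ ∑ s, b s = 1

/-- The Bayes filter for a POMDP with transition probabilities `trans` and observation
likelihoods `O`: given a belief `b`, an observation `y` and an action `a`, it returns the
updated belief `b'(s') ∝ ∑ₛ b(s) O(y|s,a) trans(s'|s,a)` (with a junk value when the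
observation has zero probability). -/
noncomputable def bayesUpdate [Fintype S] (trans : S → A → S → ℝ) (O : S → A → Y → ℝ)
    (b : S → ℝ) (y : Y) (a : A) : S → ℝ :=
  if (∑ s, b s * O s a y) = 0 then b
  else fun s' => (∑ s, b s * O s a y * trans s a s') / (∑ s, b s * O s a y)

/-- The bounded-Lipschitz (Dudley) function class on the belief simplex `Δ(S)` metrized by
the total variation distance `d_TV(b,b') = ∑ₛ |b(s) − b'(s)|`: functions `f` with
`‖f‖_∞ + ‖f‖_Lip ≤ 1`. -/
def blClass (S : Type u) [Fintype S] : Set ((S → ℝ) → ℝ) :=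
  {f | ∃ M L : ℝ, 0 ≤ M ∧ 0 ≤ L ∧ M + L ≤ 1 ∧
    (∀ b, IsBelief b → |f b| ≤ M) ∧
    (∀ b b', IsBelief b → IsBelief b' → |f b - f b'| ≤ L * ∑ s, |b s - b' s|)}

/-- A linear kernel with nonnegative rows of mass at most one is an `ℓ¹` contraction. -/
lemma sum_abs_kernel_sub_le {ι κ : Type*} [Fintype ι] [Fintype κ] (K : ι → κ → ℝ)
    (hK0 : ∀ i k, 0 ≤ K i k) (hK1 : ∀ i, ∑ k, K i k ≤ 1) (b c : ι → ℝ) :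
    ∑ k, |(∑ i, b i * K i k) - ∑ i, c i * K i k| ≤ ∑ i, |b i - c i| := by
  calc ∑ k, |(∑ i, b i * K i k) - ∑ i, c i * K i k|
      ≤ ∑ k, ∑ i, |b i - c i| * K i k := by
        refine Finset.sum_le_sum fun k _ => ?_
        rw [← Finset.sum_sub_distrib]
        refine (Finset.abs_sum_le_sum_abs _ _).trans_eq (Finset.sum_congr rfl fun i _ => ?_)
        rw [← sub_mul, abs_mul, abs_of_nonneg (hK0 i k)]
    _ = ∑ i, |b i - c i| * ∑ k, K i k := by
        rw [Finset.sum_comm]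
        simp_rw [Finset.mul_sum]
    _ ≤ ∑ i, |b i - c i| :=
        Finset.sum_le_sum fun i _ => mul_le_of_le_one_right (abs_nonneg _) (hK1 i)

section BayesUpdate

variable [Fintype S] {trans : S → A → S → ℝ} {O : S → A → Y → ℝ}

lemma IsBelief.sum_mul_nonneg {b : S → ℝ} (hb : IsBelief b) (hO0 : ∀ s a y, 0 ≤ O s a y)
    (y : Y) (a : A) : 0 ≤ ∑ s, b s * O s a y :=
  Finset.sum_nonneg fun s _ => mul_nonneg (hb.1 s) (hO0 s a y)

lemma IsBelief.sum_sum_mul_eq_one [Fintype Y] {b : S → ℝ} (hb : IsBelief b)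
    (hO1 : ∀ s a, ∑ y, O s a y = 1) (a : A) : ∑ y, ∑ s, b s * O s a y = 1 := by
  rw [Finset.sum_comm]
  simp_rw [← Finset.mul_sum, hO1, mul_one]
  exact hb.2

lemma isBelief_bayesUpdate (htrans0 : ∀ s a s', 0 ≤ trans s a s')
    (htrans1 : ∀ s a, ∑ s', trans s a s' = 1) (hO0 : ∀ s a y, 0 ≤ O s a y)
    {b : S → ℝ} (hb : IsBelief b) (y : Y) (a : A) :
    IsBelief (bayesUpdate trans O b y a) := by
  unfold bayesUpdate
  split_ifs with h
  · exact hb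
  refine ⟨fun s' => div_nonneg (Finset.sum_nonneg fun s _ => ?_)
    (hb.sum_mul_nonneg hO0 y a), ?_⟩
  · exact mul_nonneg (mul_nonneg (hb.1 s) (hO0 s a y)) (htrans0 s a s')
  · rw [← Finset.sum_div, Finset.sum_comm]
    simp_rw [← Finset.mul_sum, htrans1, mul_one]
    exact div_self h

/-- The observation probability times the updated belief is the unnormalized filter. -/
lemma mul_bayesUpdate (hO0 : ∀ s a y, 0 ≤ O s a y) {b : S → ℝ} (hb : IsBelief b)
    (y : Y) (a : A) (s' : S) :
    (∑ s, b s * O s a y) * bayesUpdate trans O b y a s' =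
      ∑ s, b s * O s a y * trans s a s' := by
  unfold bayesUpdate
  split_ifs with h
  · have h0 := (Finset.sum_eq_zero_iff_of_nonneg
      fun s _ => mul_nonneg (hb.1 s) (hO0 s a y)).1 h
    rw [h, zero_mul, Finset.sum_eq_zero]
    intro s hs
    rw [h0 s hs, zero_mul]
  · exact mul_div_cancel₀ _ h

/-- Averaged over the observations, the Bayes filter is `2`-Lipschitz in the prior belief. -/
lemma sum_mul_sum_abs_bayesUpdate_sub_le [Fintype Y] (htrans0 : ∀ s a s', 0 ≤ trans s a s')
    (htrans1 : ∀ s a, ∑ s', trans s a s' = 1) (hO0 : ∀ s a y, 0 ≤ O s a y)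
    (hO1 : ∀ s a, ∑ y, O s a y = 1) {b c : S → ℝ} (hb : IsBelief b) (hc : IsBelief c) (a : A) :
    ∑ y, (∑ s, b s * O s a y) *
        ∑ s', |bayesUpdate trans O b y a s' - bayesUpdate trans O c y a s'| ≤
      2 * ∑ s, |b s - c s| := by
  have hobs : ∑ y, |(∑ s, b s * O s a y) - ∑ s, c s * O s a y| ≤ ∑ s, |b s - c s| :=
    sum_abs_kernel_sub_le (fun s y => O s a y) (fun s y => hO0 s a y) (fun s => (hO1 s a).le) b c
  have hjoint : ∑ k : Y × S, |(∑ s, b s * (O s a k.1 * trans s a k.2)) -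
      ∑ s, c s * (O s a k.1 * trans s a k.2)| ≤ ∑ s, |b s - c s| := by
    refine sum_abs_kernel_sub_le (fun s (k : Y × S) => O s a k.1 * trans s a k.2)
      (fun s k => mul_nonneg (hO0 s a k.1) (htrans0 s a k.2)) (fun s => ?_) b c
    rw [Fintype.sum_prod_type]
    simp_rw [← Finset.mul_sum, htrans1, mul_one, hO1]
    exact le_rfl
  rw [Fintype.sum_prod_type] at hjoint
  simp_rw [← mul_assoc] at hjoint
  have key : ∀ y, (∑ s, b s * O s a y) *
        ∑ s', |bayesUpdate trans O b y a s' - bayesUpdate trans O c y a s'| ≤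
      (∑ s', |(∑ s, b s * O s a y * trans s a s') - ∑ s, c s * O s a y * trans s a s'|) +
        |(∑ s, b s * O s a y) - ∑ s, c s * O s a y| := by
    intro y
    have hC := isBelief_bayesUpdate htrans0 htrans1 hO0 hc y a
    rw [← mul_one |(∑ s, b s * O s a y) - ∑ s, c s * O s a y|, ← hC.2, Finset.mul_sum,
      Finset.mul_sum, ← Finset.sum_add_distrib]
    refine Finset.sum_le_sum fun s' _ => ?_
    rw [← mul_bayesUpdate hO0 hb, ← mul_bayesUpdate hO0 hc]
    have hp0 := hb.sum_mul_nonneg hO0 y a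
    have hC0 := hC.1 s'
    generalize ∑ s, b s * O s a y = p at *
    generalize ∑ s, c s * O s a y = q at *
    generalize bayesUpdate trans O b y a s' = v at *
    generalize bayesUpdate trans O c y a s' = w at *
    calc p * |v - w| = |(p * v - q * w) - (p - q) * w| := by
          rw [← abs_of_nonneg hp0, ← abs_mul, abs_of_nonneg hp0]
          congr 1
          ring
      _ ≤ |p * v - q * w| + |(p - q) * w| := abs_sub _ _
      _ = |p * v - q * w| + |p - q| * w := by rw [abs_mul (p - q), abs_of_nonneg hC0]
  calc _ ≤ _ := Finset.sum_le_sum fun y _ => key y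
    _ ≤ 2 * ∑ s, |b s - c s| := by
      rw [Finset.sum_add_distrib]
      linarith

end BayesUpdate

/-- The expectations of `r` under `b` and `c` differ by at most `‖b - c‖₁` times the width of
an interval containing the values of `r`. -/
lemma IsBelief.abs_sum_mul_sub_le [Fintype S] {b c : S → ℝ} (hb : IsBelief b) (hc : IsBelief c)
    {r : S → ℝ} {lo hi : ℝ} (hlo : ∀ s, lo ≤ r s) (hhi : ∀ s, r s ≤ hi) :
    |(∑ s, b s * r s) - ∑ s, c s * r s| ≤ (∑ s, |b s - c s|) * (hi - lo) := by
  have h : (∑ s, b s * r s) - ∑ s, c s * r s = ∑ s, (b s - c s) * (r s - lo) := by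
    have h1 : ∑ s, (b s - c s) * lo = 0 := by
      rw [← Finset.sum_mul, Finset.sum_sub_distrib, hb.2, hc.2, sub_self, zero_mul]
    simp_rw [mul_sub, Finset.sum_sub_distrib, h1, sub_zero, sub_mul, Finset.sum_sub_distrib]
  rw [h, Finset.sum_mul]
  refine (Finset.abs_sum_le_sum_abs _ _).trans (Finset.sum_le_sum fun s _ => ?_)
  rw [abs_mul, abs_of_nonneg (sub_nonneg.2 (hlo s))]
  exact mul_le_mul_of_nonneg_left (sub_le_sub_right (hhi s) lo) (abs_nonneg _)

/-- **ε-sufficient statistics induce an AIS.**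
Consider a POMDP with finite state space `S`, finite action space `A`, finite observation
space `Y`, bounded reward `r`, transition probabilities `trans`, observation likelihoods `O`
and belief process `btrue t h = b_t(·|h_t)`, which evolves according to the Bayes filter and
determines the conditional law `P(Y_t = y | h_t, a_t) = ∑ₛ b_t(s|h_t) O(y|s,a_t)` of the
observations as well as the expected reward `E[R_t | h_t, a_t] = ∑ₛ b_t(s|h_t) r(s,a_t)`.
Suppose `{φ_t}` and `{b̂_t}` form an `ε`-sufficient statistic, i.e.
`‖b̂_t(·|φ_t(h_t)) − b_t(·|h_t)‖₁ ≤ ε`.  Then the compression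
`σ̂_t(h_t) = b̂_t(·|φ_t(h_t))`, with reward approximation `r̂(b,a) = ∑ₛ b(s) r(s,a)` and the
update kernel induced by the Bayes filter applied to the approximate beliefs, is an
`(ε·Span(r), 3ε)`-approximate information state generator for the bounded-Lipschitz IPM on
probability measures over `(Δ(S), d_TV)`: it satisfies (AP1) with constant `ε·Span(r)` and
(AP2) with constant `3ε`. -/
theorem eps_sufficient_statistic_is_ais
    {H0 : Type u} [Fintype S] [Fintype A] [Fintype Y]
    [Nonempty S] [Nonempty A] [Nonempty Y]
    (r : S → A → ℝ)
    (trans : S → A → S → ℝ)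
    (htrans0 : ∀ s a s', 0 ≤ trans s a s') (htrans1 : ∀ s a, ∑ s', trans s a s' = 1)
    (O : S → A → Y → ℝ)
    (hO0 : ∀ s a y, 0 ≤ O s a y) (hO1 : ∀ s a, ∑ y, O s a y = 1)
    -- the true belief process and its Bayes-filter evolution
    (btrue : ∀ t, Hist H0 Y A t → (S → ℝ))
    (hbtrue : ∀ t h, IsBelief (btrue t h))
    (hfilter : ∀ t (h : Hist H0 Y A t) (y : Y) (a : A),
      btrue (t+1) ((h, y, a) : Hist H0 Y A (t+1)) = bayesUpdate trans O (btrue t h) y a)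
    -- the ε-sufficient statistic
    {Φ : ℕ → Type u} (φ : ∀ t, Hist H0 Y A t → Φ t)
    (bhat : ∀ t, Φ t → (S → ℝ))
    (hbhat : ∀ t p, IsBelief (bhat t p))
    (ε : ℝ)
    (hsuff : ∀ t (h : Hist H0 Y A t), ∑ s, |bhat t (φ t h) s - btrue t h s| ≤ ε) :
    ∀ t (h : Hist H0 Y A t) (a : A),
      -- (AP1): the reward approximation error is at most `ε · Span(r)`
      |(∑ s, btrue t h s * r s a) - ∑ s, bhat t (φ t h) s * r s a| ≤
        ε * (sSup (Set.range fun p : S × A => r p.1 p.2) -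
             sInf (Set.range fun p : S × A => r p.1 p.2)) ∧
      -- (AP2): the bounded-Lipschitz IPM between the law of `σ̂_{t+1}(H_{t+1})` given
      -- `(h_t, a_t)` and the AIS update kernel `P̂(·|σ̂_t(h_t), a_t)` (the pushforward of
      -- the predicted observation law under the Bayes filter applied to the approximate
      -- belief) is at most `3ε`
      sSup ((fun f =>
          |(∑ y, (∑ s, btrue t h s * O s a y) *
              f (bhat (t+1) (φ (t+1) ((h, y, a) : Hist H0 Y A (t+1))))) -
            ∑ y, (∑ s, bhat t (φ t h) s * O s a y) *
              f (bayesUpdate trans O (bhat t (φ t h)) y a)|) '' blClass S) ≤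
        3 * ε := by
  intro t h a
  have hb := hbtrue t h
  have hc := hbhat t (φ t h)
  have hbc : ∑ s, |btrue t h s - bhat t (φ t h) s| ≤ ε := by
    simpa only [abs_sub_comm] using hsuff t h
  have hε : 0 ≤ ε := (Finset.sum_nonneg fun s _ => abs_nonneg _).trans hbc
  constructor
  · have hfin := Set.finite_range fun p : S × A => r p.1 p.2
    have hlo : ∀ s, sInf (Set.range fun p : S × A => r p.1 p.2) ≤ r s a :=
      fun s => csInf_le hfin.bddBelow ⟨(s, a), rfl⟩
    have hhi : ∀ s, r s a ≤ sSup (Set.range fun p : S × A => r p.1 p.2) :=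
      fun s => le_csSup hfin.bddAbove ⟨(s, a), rfl⟩
    obtain ⟨s₀⟩ := ‹Nonempty S›
    exact (hb.abs_sum_mul_sub_le hc hlo hhi).trans
      (mul_le_mul_of_nonneg_right hbc (sub_nonneg.2 ((hlo s₀).trans (hhi s₀))))
  refine Real.sSup_le ?_ (by positivity)
  rintro _ ⟨f, ⟨M, L, hM, hL, hML, hfM, hfL⟩, rfl⟩
  have hobs : ∑ y, |(∑ s, btrue t h s * O s a y) - ∑ s, bhat t (φ t h) s * O s a y| ≤ ε :=
    (sum_abs_kernel_sub_le (fun s y => O s a y) (fun s y => hO0 s a y)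
      (fun s => (hO1 s a).le) _ _).trans hbc
  have hB2 := (sum_mul_sum_abs_bayesUpdate_sub_le htrans0 htrans1 hO0 hO1 hb hc a).trans
    (mul_le_mul_of_nonneg_left hbc zero_le_two)
  have hp1 := hb.sum_sum_mul_eq_one hO1 a
  have key : ∀ y, |(∑ s, btrue t h s * O s a y) *
        f (bhat (t+1) (φ (t+1) ((h, y, a) : Hist H0 Y A (t+1)))) -
      (∑ s, bhat t (φ t h) s * O s a y) * f (bayesUpdate trans O (bhat t (φ t h)) y a)| ≤
      (∑ s, btrue t h s * O s a y) * (L * ε) +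
      L * ((∑ s, btrue t h s * O s a y) * ∑ s', |bayesUpdate trans O (btrue t h) y a s' -
        bayesUpdate trans O (bhat t (φ t h)) y a s'|) +
      M * |(∑ s, btrue t h s * O s a y) - ∑ s, bhat t (φ t h) s * O s a y| := by
    intro y
    have hp0 := hb.sum_mul_nonneg hO0 y a
    have hB := isBelief_bayesUpdate htrans0 htrans1 hO0 hb y a
    have hC := isBelief_bayesUpdate htrans0 htrans1 hO0 hc y a
    have hnext := hsuff (t+1) ((h, y, a) : Hist H0 Y A (t+1))
    rw [hfilter] at hnext
    have h1 := (hfL _ _ (hbhat (t+1) (φ (t+1) ((h, y, a) : Hist H0 Y A (t+1)))) hB).trans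
      (mul_le_mul_of_nonneg_left hnext hL)
    have h2 := hfL _ _ hB hC
    have h3 := hfM _ hC
    generalize ∑ s, btrue t h s * O s a y = p at *
    generalize ∑ s, bhat t (φ t h) s * O s a y = q at *
    generalize f (bhat (t+1) (φ (t+1) ((h, y, a) : Hist H0 Y A (t+1)))) = u at *
    generalize f (bayesUpdate trans O (btrue t h) y a) = v at *
    generalize f (bayesUpdate trans O (bhat t (φ t h)) y a) = w at *
    have e : p * u - q * w = p * (u - v) + p * (v - w) + (p - q) * w := by ring
    rw [e]
    refine (abs_add_three _ _ _).trans ?_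
    rw [abs_mul, abs_mul, abs_mul, abs_of_nonneg hp0, mul_left_comm L p, mul_comm M]
    gcongr
  change |_ - _| ≤ _
  rw [← Finset.sum_sub_distrib]
  refine (Finset.abs_sum_le_sum_abs _ _).trans ((Finset.sum_le_sum fun y _ => key y).trans ?_)
  rw [Finset.sum_add_distrib, Finset.sum_add_distrib, ← Finset.sum_mul, ← Finset.mul_sum,
    ← Finset.mul_sum, hp1]
  have h2 := mul_le_mul_of_nonneg_left hB2 hL
  have h3 := mul_le_mul_of_nonneg_left hobs hM
  have h4 := mul_le_mul_of_nonneg_right hML hε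
  have h5 := mul_nonneg hM hε
  linarith
end
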